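/- Let $F$ be a finite set and let $(X_i)_{i\in F}$, $(X'_i)_{i\in F}$, and $(X_{j(i)})_{i,j\in F}$ be collections of nonnegative random variables with finite moment generating functions, defined on the same probability space, satisfying: (a) for all $i$, $X_i \le X'_i$; (b) for all $i$, the random variables $X'_i$ and $\sum_{j\in F} X_{j(i)}$ are independent; (c) for all $i$, $\sum_{j\in F} X_{j(i)} \le \sum_{j\in F} X_j$; (d) there is a constant $a > 0$ such that for all $i$, on the event $\{X_i > 0\}$ one has $\sum_{j\in F} X_j \le a + \sum_{j\in F} X_{j(i)}$. Let $\lambda := \sum_{i\in F} \mathbb{E}(X'_i)$. Then for any $t \ge \lambda$, $\mathbb{P}\big(\sum_{i\in F} X_i \ge t\big) \le \exp\big(-\frac{t}{a}\big(\log\frac{t}{\lambda} - 1 + \frac{\lambda}{t}\big)\big)$. -/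

import Mathlib

open MeasureTheory ProbabilityTheory Real

theorem aux_aemeas {Ω : Type*} [MeasurableSpace Ω] {μ : Measure Ω} {Y : Ω → ℝ}
    (h : Integrable (fun ω => Real.exp (1 * Y ω)) μ) : AEMeasurable Y μ := by
  have := Real.measurable_log.comp_aemeasurable h.1.aemeasurable
  refine this.congr (Filter.Eventually.of_forall fun ω => ?_)
  simp

theorem aux_int {Ω : Type*} [MeasurableSpace Ω] {μ : Measure Ω} [IsProbabilityMeasure μ]
    {F : Type*} (X : F → Ω → ℝ)
    (hm : ∀ i, AEMeasurable (X i) μ)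
    (h : ∀ i, ∀ θ : ℝ, 0 ≤ θ → Integrable (fun ω => Real.exp (θ * X i ω)) μ)
    (s : Finset F) :
    ∀ θ : ℝ, 0 ≤ θ → Integrable (fun ω => Real.exp (θ * ∑ i ∈ s, X i ω)) μ := by
  classical
  induction s using Finset.induction_on with
  | empty => intro θ _; simp
  | insert i s hi ih =>
    intro θ hθ
    have hsm : AEMeasurable (fun ω => ∑ j ∈ s, X j ω) μ :=
      Finset.aemeasurable_fun_sum s fun j _ => hm j
    have hm' : AEMeasurable (fun ω => Real.exp (θ * ∑ j ∈ insert i s, X j ω)) μ :=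
      Real.measurable_exp.comp_aemeasurable
        ((Finset.aemeasurable_fun_sum _ fun j _ => hm j).const_mul θ)
    refine ((h i (2*θ) (by positivity)).add (ih (2*θ) (by positivity))).mono'
      hm'.aestronglyMeasurable (Filter.Eventually.of_forall fun ω => ?_)
    simp only [Pi.add_apply]
    rw [Finset.sum_insert hi, Real.norm_eq_abs, abs_of_pos (Real.exp_pos _), mul_add, Real.exp_add,
      show 2 * θ * X i ω = θ * X i ω + θ * X i ω by ring,
      show 2 * θ * ∑ j ∈ s, X j ω = θ * ∑ j ∈ s, X j ω + θ * ∑ j ∈ s, X j ω by ring,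
      Real.exp_add, Real.exp_add]
    nlinarith [sq_nonneg (Real.exp (θ * X i ω) - Real.exp (θ * ∑ j ∈ s, X j ω)),
      sq_nonneg (Real.exp (θ * X i ω)), sq_nonneg (Real.exp (θ * ∑ j ∈ s, X j ω))]

/-- **Theorem 3.1** (first inequality): a generic concentration inequality for sums of
dependent nonnegative random variables. -/
theorem dependent_sum_tail {Ω : Type*} [MeasurableSpace Ω] (μ : Measure Ω)
    [IsProbabilityMeasure μ] {F : Type*} [Fintype F]
    (X X' : F → Ω → ℝ) (Xc : F → F → Ω → ℝ)
    (hXnn : ∀ i ω, 0 ≤ X i ω) (hX'nn : ∀ i ω, 0 ≤ X' i ω) (hXcnn : ∀ i j ω, 0 ≤ Xc i j ω)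
    (hmgfX : ∀ i, ∀ θ : ℝ, 0 ≤ θ → Integrable (fun ω => Real.exp (θ * X i ω)) μ)
    (hmgfX' : ∀ i, ∀ θ : ℝ, 0 ≤ θ → Integrable (fun ω => Real.exp (θ * X' i ω)) μ)
    (hmgfXc : ∀ i j, ∀ θ : ℝ, 0 ≤ θ → Integrable (fun ω => Real.exp (θ * Xc i j ω)) μ)
    (ha : ∀ i ω, X i ω ≤ X' i ω)
    (hb : ∀ i, IndepFun (X' i) (fun ω => ∑ j, Xc i j ω) μ)
    (hc : ∀ i ω, ∑ j, Xc i j ω ≤ ∑ j, X j ω)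
    (a : ℝ) (hapos : 0 < a)
    (hd : ∀ i ω, 0 < X i ω → ∑ j, X j ω ≤ a + ∑ j, Xc i j ω)
    (lam : ℝ) (hlam : lam = ∑ i, ∫ ω, X' i ω ∂μ)
    (t : ℝ) (ht : lam ≤ t) :
    μ {ω | t ≤ ∑ i, X i ω} ≤
      ENNReal.ofReal
        (Real.exp (-(t / a) * (Real.log (t / lam) - 1 + lam / t))) := by
  have hXm : ∀ i, AEMeasurable (X i) μ := fun i => aux_aemeas (hmgfX i 1 zero_le_one)
  have hX'm : ∀ i, AEMeasurable (X' i) μ := fun i => aux_aemeas (hmgfX' i 1 zero_le_one)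
  have hXcm : ∀ i j, AEMeasurable (Xc i j) μ := fun i j => aux_aemeas (hmgfXc i j 1 zero_le_one)
  set S : Ω → ℝ := fun ω => ∑ i, X i ω with hS
  have hSnn : ∀ ω, 0 ≤ S ω := fun ω => Finset.sum_nonneg fun i _ => hXnn i ω
  have hSm : AEMeasurable S μ := Finset.aemeasurable_fun_sum _ fun j _ => hXm j
  have hX'int : ∀ i, Integrable (X' i) μ := fun i => by
    refine (hmgfX' i 1 zero_le_one).mono' (hX'm i).aestronglyMeasurable
      (Filter.Eventually.of_forall fun ω => ?_)
    rw [Real.norm_eq_abs, abs_of_nonneg (hX'nn i ω), one_mul]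
    linarith [Real.add_one_le_exp (X' i ω)]
  have hlamnn : 0 ≤ lam := by
    rw [hlam]; exact Finset.sum_nonneg fun i _ => integral_nonneg (hX'nn i)
  rcases hlamnn.eq_or_lt with h0 | hlpos
  · subst h0
    refine prob_le_one.trans ?_
    rw [← ENNReal.ofReal_one]
    refine ENNReal.ofReal_le_ofReal (Real.one_le_exp ?_)
    simp
    positivity
  have htpos : 0 < t := hlpos.trans_le ht
  have hSint0 : ∀ θ : ℝ, 0 ≤ θ → Integrable (fun ω => Real.exp (θ * S ω)) μ :=
    aux_int X hXm hmgfX Finset.univ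
  have hSint : ∀ θ : ℝ, Integrable (fun ω => Real.exp (θ * S ω)) μ := fun θ => by
    refine (hSint0 |θ| (abs_nonneg _)).mono'
      (Real.measurable_exp.comp_aemeasurable (hSm.const_mul θ)).aestronglyMeasurable
      (Filter.Eventually.of_forall fun ω => ?_)
    rw [Real.norm_eq_abs, abs_of_pos (Real.exp_pos _)]
    exact Real.exp_le_exp.2 (mul_le_mul_of_nonneg_right (le_abs_self θ) (hSnn ω))
  have hset : integrableExpSet S μ = Set.univ := Set.eq_univ_of_forall fun θ => hSint θ
  have hder : ∀ θ : ℝ, HasDerivAt (mgf S μ) (∫ ω, S ω * Real.exp (θ * S ω) ∂μ) θ := fun θ =>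
    hasDerivAt_mgf (by rw [hset]; simp)
  -- the differential inequality
  have hineq : ∀ θ : ℝ, 0 ≤ θ →
      ∫ ω, S ω * Real.exp (θ * S ω) ∂μ ≤ lam * Real.exp (θ * a) * mgf S μ θ := by
    intro θ hθ
    have hint1 : ∀ i, Integrable (fun ω => X i ω * Real.exp (θ * S ω)) μ := fun i => by
      refine (hSint (1 + θ)).mono' ((hXm i).mul
        (Real.measurable_exp.comp_aemeasurable (hSm.const_mul θ))).aestronglyMeasurable
        (Filter.Eventually.of_forall fun ω => ?_)
      rw [Real.norm_eq_abs, abs_of_nonneg (mul_nonneg (hXnn i ω) (Real.exp_pos _).le),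
        add_mul, Real.exp_add, one_mul]
      have h1 : X i ω ≤ S ω := Finset.single_le_sum (f := fun j => X j ω)
        (fun j _ => hXnn j ω) (Finset.mem_univ i)
      exact mul_le_mul_of_nonneg_right (by linarith [Real.add_one_le_exp (S ω)])
        (Real.exp_pos _).le
    have hterm : ∀ i, ∫ ω, X i ω * Real.exp (θ * S ω) ∂μ
        ≤ (∫ ω, X' i ω ∂μ) * (Real.exp (θ * a) * mgf S μ θ) := by
      intro i
      have hTm : AEMeasurable (fun ω => ∑ j, Xc i j ω) μ :=
        Finset.aemeasurable_fun_sum _ fun j _ => hXcm i j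
      have hTint : Integrable (fun ω => Real.exp (θ * ∑ j, Xc i j ω)) μ :=
        aux_int (Xc i) (hXcm i) (hmgfXc i) Finset.univ θ hθ
      have hind : IndepFun (X' i) (fun ω => Real.exp (θ * ∑ j, Xc i j ω)) μ :=
        (hb i).comp (φ := id) (ψ := fun x => Real.exp (θ * x)) measurable_id (by fun_prop)
      have hprod : Integrable (fun ω => X' i ω * Real.exp (θ * ∑ j, Xc i j ω)) μ :=
        hind.integrable_mul (hX'int i) hTint
      calc ∫ ω, X i ω * Real.exp (θ * S ω) ∂μ
          ≤ ∫ ω, Real.exp (θ * a) * (X' i ω * Real.exp (θ * ∑ j, Xc i j ω)) ∂μ := by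
            refine integral_mono (hint1 i) (hprod.const_mul _) fun ω => ?_
            simp only
            rcases (hXnn i ω).eq_or_lt with h | h
            · rw [← h, zero_mul]
              have := hX'nn i ω
              positivity
            · have h1 : Real.exp (θ * S ω)
                  ≤ Real.exp (θ * a) * Real.exp (θ * ∑ j, Xc i j ω) := by
                rw [← Real.exp_add, ← mul_add]
                exact Real.exp_le_exp.2 (mul_le_mul_of_nonneg_left (hd i ω h) hθ)
              calc _ ≤ X' i ω * (Real.exp (θ * a) * Real.exp (θ * ∑ j, Xc i j ω)) :=
                    mul_le_mul (ha i ω) h1 (Real.exp_pos _).le (hX'nn i ω)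
                _ = _ := by ring
        _ = Real.exp (θ * a) * ((∫ ω, X' i ω ∂μ) * ∫ ω, Real.exp (θ * ∑ j, Xc i j ω) ∂μ) := by
            rw [integral_const_mul]
            congr 1
            exact hind.integral_fun_mul_eq_mul_integral (hX'm i).aestronglyMeasurable hTint.1
        _ ≤ Real.exp (θ * a) * ((∫ ω, X' i ω ∂μ) * mgf S μ θ) := by
            refine mul_le_mul_of_nonneg_left (mul_le_mul_of_nonneg_left ?_
              (integral_nonneg (hX'nn i))) (Real.exp_pos _).le
            exact integral_mono hTint (hSint θ) fun ω =>
              Real.exp_le_exp.2 (mul_le_mul_of_nonneg_left (hc i ω) hθ)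
        _ = _ := by ring
    calc ∫ ω, S ω * Real.exp (θ * S ω) ∂μ
        = ∑ i, ∫ ω, X i ω * Real.exp (θ * S ω) ∂μ := by
          rw [← integral_finsetSum _ fun i _ => hint1 i]
          congr 1; ext ω
          rw [← Finset.sum_mul]
      _ ≤ ∑ i, (∫ ω, X' i ω ∂μ) * (Real.exp (θ * a) * mgf S μ θ) :=
          Finset.sum_le_sum fun i _ => hterm i
      _ = _ := by rw [← Finset.sum_mul, ← hlam]; ring
  -- integrate it
  have hG : ∀ θ : ℝ, HasDerivAt
      (fun θ => mgf S μ θ * Real.exp (-(lam / a * (Real.exp (θ * a) - 1))))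
      ((∫ ω, S ω * Real.exp (θ * S ω) ∂μ) * Real.exp (-(lam / a * (Real.exp (θ * a) - 1)))
        + mgf S μ θ * (Real.exp (-(lam / a * (Real.exp (θ * a) - 1))) *
          (-(lam / a * (Real.exp (θ * a) * (1 * a)))))) θ := fun θ =>
    (hder θ).mul (((((hasDerivAt_id θ).mul_const a).exp.sub_const 1).const_mul (lam / a)).neg.exp)
  have hanti : AntitoneOn
      (fun θ => mgf S μ θ * Real.exp (-(lam / a * (Real.exp (θ * a) - 1)))) (Set.Ici 0) := by
    refine antitoneOn_of_deriv_nonpos (convex_Ici 0)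
      (fun θ _ => (hG θ).continuousAt.continuousWithinAt)
      (fun θ _ => (hG θ).differentiableAt.differentiableWithinAt) fun θ hθ => ?_
    rw [interior_Ici, Set.mem_Ioi] at hθ
    rw [(hG θ).deriv]
    have h1 := mul_le_mul_of_nonneg_right (hineq θ hθ.le)
      (Real.exp_pos (-(lam / a * (Real.exp (θ * a) - 1)))).le
    have h2 : lam / a * (Real.exp (θ * a) * (1 * a)) = lam * Real.exp (θ * a) := by
      field_simp
    rw [h2]
    linarith
  have hmgf : ∀ θ : ℝ, 0 ≤ θ → mgf S μ θ ≤ Real.exp (lam / a * (Real.exp (θ * a) - 1)) := by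
    intro θ hθ
    have := hanti (Set.mem_Ici.2 le_rfl) (Set.mem_Ici.2 hθ) hθ
    simp only [zero_mul, Real.exp_zero, sub_self, mul_zero, neg_zero, mul_one, mgf_zero] at this
    rw [Real.exp_neg, ← div_eq_mul_inv, div_le_one (Real.exp_pos _)] at this
    exact this
  have hθ : 0 ≤ Real.log (t / lam) / a :=
    div_nonneg (Real.log_nonneg ((one_le_div hlpos).2 ht)) hapos.le
  have hch := measure_ge_le_exp_mul_mgf (X := S) (μ := μ) t hθ (hSint _)
  rw [← ofReal_measureReal]
  refine ENNReal.ofReal_le_ofReal (hch.trans ?_)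
  refine (mul_le_mul_of_nonneg_left (hmgf _ hθ) (Real.exp_pos _).le).trans (le_of_eq ?_)
  rw [← Real.exp_add, div_mul_cancel₀ _ hapos.ne', Real.exp_log (div_pos htpos hlpos)]
  congr 1
  field_simp
  ring
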